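/- Assume |G| ≥ 2, N ≥ 2 and M ≥ 1. The map Φ̃ : A_alg^{(N)} → A_alg^{(N+M)} defined by Φ̃(A) := Π_alg^{(N+M)}(A ⊗ 1_{H_M}) is not multiplicative: there exist A, B ∈ A_alg^{(N)} with Φ̃(AB) ≠ Φ̃(A)Φ̃(B). In fact, for any h ≠ j in G^{N−1}, Φ̃(|h;𝟙⟩⟨j;𝟙|) · Φ̃(|j;𝟙⟩⟨h;𝟙|) ≠ Φ̃(|h;𝟙⟩⟨h;𝟙|). -/

import Mathlib

noncomputable section

open Matrix

namespace QRF

section Defs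

variable (G : Type) [Fintype G] [DecidableEq G] [CommGroup G]

/-- The `K`-particle Hilbert space `ℂ^{G^K}` (as functions `G^K → ℂ`). -/
abbrev Vec (K : ℕ) : Type := (Fin K → G) → ℂ

/-- Linear operators on the `K`-particle Hilbert space. -/
abbrev Op (K : ℕ) : Type := Matrix (Fin K → G) (Fin K → G) ℂ

variable {G}

/-- The standard basis vector `|x⟩`. -/
def ket {K : ℕ} (x : Fin K → G) : Vec G K := fun y => if y = x then 1 else 0

/-- The global translation `T_g`, `T_g |x₁,…,x_K⟩ = |g x₁, …, g x_K⟩`. -/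
def trans {K : ℕ} (g : G) : Op G K :=
  Matrix.of fun x y => if x = (fun i => g * y i) then 1 else 0

/-- The configuration `(g, h₁ g, …, h_k g)`, i.e. `|g, hg⟩`. -/
def cfg {k : ℕ} (h : Fin k → G) (g : G) : Fin (k + 1) → G :=
  Fin.cons g fun i => h i * g

/-- The inner product `⟨v, w⟩` (antilinear in the first argument). -/
def inn {K : ℕ} (v w : Vec G K) : ℂ := star v ⬝ᵥ w

/-- The rank-one operator `|v⟩⟨w|`. -/
def outer {K : ℕ} (v w : Vec G K) : Op G K :=
  Matrix.of fun x y => v x * (starRingEnd ℂ) (w y)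

/-- The matrix element `⟨v|A|w⟩`. -/
def melem {K : ℕ} (v : Vec G K) (A : Op G K) (w : Vec G K) : ℂ :=
  star v ⬝ᵥ A.mulVec w

/-- The Hilbert–Schmidt inner product `⟨A,B⟩ := tr(A† B)`. -/
def hsInner {K : ℕ} (A B : Op G K) : ℂ := (Aᴴ * B).trace

variable (G)

/-- The symmetry group `U_sym` of relation-conditional global translations
(for `k+1` particles). -/
def Usym (k : ℕ) : Set (Op G (k + 1)) :=
  {U | U ∈ Matrix.unitaryGroup (Fin (k + 1) → G) ℂ ∧
    ∃ c : (Fin k → G) → G, ∀ (h : Fin k → G) (g : G),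
      U.mulVec (ket (cfg h g)) = (trans (c h)).mulVec (ket (cfg h g))}

/-- The characters of `G`: monoid homomorphisms `G → ℂ` of modulus one. -/
def Ghat : Type := {χ : G →* ℂ // ∀ g : G, ‖χ g‖ = 1}

/-- The trivial character `𝟙`. -/
instance : One (Ghat G) := ⟨⟨1, fun g => by simp⟩⟩

variable {G}

/-- The vector `|h;χ⟩ := |G|^{-1/2} ∑_{g ∈ G} χ(g⁻¹) |g, hg⟩`. -/
def relKet {k : ℕ} (h : Fin k → G) (χ : Ghat G) : Vec G (k + 1) :=
  ((Real.sqrt (Fintype.card G) : ℂ))⁻¹ • ∑ g : G, χ.1 g⁻¹ • ket (cfg h g)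

variable (G)

/-- The relational subspace `H_phys = span{|h;𝟙⟩}`. -/
def Hphys (k : ℕ) : Submodule ℂ (Vec G (k + 1)) :=
  Submodule.span ℂ {v | ∃ h : Fin k → G, v = relKet h (1 : Ghat G)}

/-- `Π_phys = ∑_h |h;𝟙⟩⟨h;𝟙|`, the orthogonal projection onto `H_phys`. -/
def Piphys (k : ℕ) : Op G (k + 1) :=
  ∑ h : Fin k → G, outer (relKet h (1 : Ghat G)) (relKet h (1 : Ghat G))

variable {G}

/-- `Π_{h;χ≠𝟙} = ∑_{χ ∈ Ĝ, χ ≠ 𝟙} |h;χ⟩⟨h;χ|`. -/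
def PiNot1 {k : ℕ} (h : Fin k → G) : Op G (k + 1) :=
  ∑ᶠ (χ : Ghat G) (_ : χ ≠ 1), outer (relKet h χ) (relKet h χ)

variable (G)

/-- The invariant algebra `A_inv`. -/
def Ainv (k : ℕ) : Set (Op G (k + 1)) :=
  {A | ∀ U ∈ Usym G k, U * A * Uᴴ = A}

/-- The incoherent group average (twirl) `Π_inv` over `U_sym`. -/
def Piinv (k : ℕ) (ρ : Op G (k + 1)) : Op G (k + 1) :=
  (Nat.card ↥(Usym G k) : ℂ)⁻¹ • ∑ᶠ U ∈ Usym G k, U * ρ * Uᴴ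

/-- The algebra `A_phys` of relational observables (operators supported on `H_phys`). -/
def Aphys (k : ℕ) : Set (Op G (k + 1)) :=
  {A | A = Piphys G k * A * Piphys G k}

/-- The algebra `A_alg`. -/
def Aalg (k : ℕ) : Set (Op G (k + 1)) :=
  {X | ∃ B ∈ Aphys G k, ∃ a : (Fin k → G) → ℂ,
      X = B + ∑ h : Fin k → G, a h • PiNot1 h}

variable {G}

/-- The vector `|e⟩_i ⊗ φ`. -/
def insVec {k : ℕ} (i : Fin (k + 1)) (φ : (Fin k → G) → ℂ) : Vec G (k + 1) :=
  fun x => if x i = 1 then φ (fun j => x (i.succAbove j)) else 0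

/-- The operator `|e⟩⟨e|_i ⊗ A`. -/
def eAop {k : ℕ} (i : Fin (k + 1)) (A : Matrix (Fin k → G) (Fin k → G) ℂ) :
    Op G (k + 1) :=
  Matrix.of fun x y =>
    if x i = 1 ∧ y i = 1 then
      A (fun j => x (i.succAbove j)) (fun j => y (i.succAbove j))
    else 0

/-- `ψ` is `i`-alignable. -/
def IAlignable {k : ℕ} (i : Fin (k + 1)) (ψ : Vec G (k + 1)) : Prop :=
  ∃ (θ : ℝ) (U : Op G (k + 1)) (φ : (Fin k → G) → ℂ),
    U ∈ Usym G k ∧ ψ = Complex.exp (θ * Complex.I) • U.mulVec (insVec i φ)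

/-- `ψ` is alignable. -/
def Alignable {k : ℕ} (ψ : Vec G (k + 1)) : Prop := ∃ i, IAlignable i ψ

/-- Symmetry equivalence of state vectors (up to a global phase). -/
def SymmEquiv {k : ℕ} (ψ ψ' : Vec G (k + 1)) : Prop :=
  ∃ (θ : ℝ) (U : Op G (k + 1)),
    U ∈ Usym G k ∧ ψ' = Complex.exp (θ * Complex.I) • U.mulVec ψ

/-- `P` is the orthogonal projection of operator space onto the set `S`,
with respect to the Hilbert–Schmidt inner product. -/
def IsHSProj {K : ℕ} (S : Set (Op G K)) (P : Op G K →ₗ[ℂ] Op G K) : Prop :=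
  (∀ ρ, P ρ ∈ S) ∧ (∀ A ∈ S, P A = A) ∧
    ∀ ρ σ, hsInner (P ρ) σ = hsInner ρ (P σ)

/-- First `n+1` components of an `(n+1)+(m+1)`-particle configuration. -/
def split1 {n m : ℕ} (x : Fin (n + m + 1 + 1) → G) : Fin (n + 1) → G :=
  fun i => x ⟨i.1, by have := i.2; omega⟩

/-- Last `m+1` components of an `(n+1)+(m+1)`-particle configuration. -/
def split2 {n m : ℕ} (x : Fin (n + m + 1 + 1) → G) : Fin (m + 1) → G :=
  fun i => x ⟨n + 1 + i.1, by have := i.2; omega⟩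

/-- The tensor product `A ⊗ B` of operators, under the identification
`H_{N+M} ≅ H_N ⊗ H_M`, `|x,y⟩ ↦ |x⟩ ⊗ |y⟩`. -/
def tensorOp {n m : ℕ} (A : Op G (n + 1)) (B : Op G (m + 1)) :
    Op G (n + m + 1 + 1) :=
  Matrix.of fun x y => A (split1 x) (split1 y) * B (split2 x) (split2 y)

/-- Concatenation `(h, g⃗)` of relation tuples. -/
def relcat {n m : ℕ} (h : Fin n → G) (gv : Fin (m + 1) → G) :
    Fin (n + m + 1) → G :=
  (Fin.append h gv : Fin (n + (m + 1)) → G)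

/-- Joining of configurations `(x, z)`. -/
def join {n m : ℕ} (x : Fin (n + 1) → G) (z : Fin (m + 1) → G) :
    Fin (n + m + 1 + 1) → G :=
  fun i => if hi : i.1 < n + 1 then x ⟨i.1, hi⟩
           else z ⟨i.1 - (n + 1), by have := i.2; omega⟩

/-- The standard partial trace over the last `m+1` particles. -/
def ptraceM {n m : ℕ} (ρ : Op G (n + m + 1 + 1)) : Op G (n + 1) :=
  Matrix.of fun x y => ∑ z : Fin (m + 1) → G, ρ (join x z) (join y z)

end Defs

/-- The relation tuple of a configuration, i.e. the `h` with `x = (g, h g)`. -/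
def relOf {G : Type} [CommGroup G] {k : ℕ} (x : Fin (k + 1) → G) : Fin k → G :=
  fun i => x i.succ * (x 0)⁻¹

lemma relOf_cfg {G : Type} [CommGroup G] {k : ℕ} (h : Fin k → G) (g : G) :
    relOf (cfg h g) = h := by
  ext i
  simp [relOf, cfg]

lemma cfg_relOf {G : Type} [CommGroup G] {k : ℕ} (x : Fin (k + 1) → G) :
    cfg (relOf x) (x 0) = x := by
  ext i
  refine Fin.cases ?_ (fun i => ?_) i <;> simp [relOf, cfg]

/-- A configuration is determined by its relation tuple and its first entry. -/
def cfgEquiv {G : Type} [CommGroup G] (k : ℕ) : (Fin k → G) × G ≃ (Fin (k + 1) → G) where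
  toFun p := cfg p.1 p.2
  invFun x := (relOf x, x 0)
  left_inv p := Prod.ext (relOf_cfg p.1 p.2) (by simp [cfg])
  right_inv x := cfg_relOf x

lemma relOf_split1 {G : Type} [CommGroup G] {n m : ℕ} (x : Fin (n + m + 1 + 1) → G) :
    relOf (split1 x) = fun i => relOf x ⟨i.1, by have := i.2; omega⟩ := rfl

lemma relOf_split1_congr {G : Type} [CommGroup G] {n m : ℕ} {x y : Fin (n + m + 1 + 1) → G}
    (hxy : relOf x = relOf y) : relOf (split1 x) = relOf (split1 y) := by
  rw [relOf_split1, relOf_split1, hxy]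

lemma eq_of_relOf_eq_of_split2_eq {G : Type} [CommGroup G] {n m : ℕ}
    {x y : Fin (n + m + 1 + 1) → G}
    (hxy : relOf x = relOf y) (h2 : split2 x = split2 y) : x = y := by
  have h0 := congrFun hxy ⟨n, by omega⟩
  have h1 : x ⟨n + 1, by omega⟩ = y ⟨n + 1, by omega⟩ := congrFun h2 0
  have hx0 : x 0 = y 0 := by
    simpa [relOf, h1] using h0
  rw [← cfg_relOf x, ← cfg_relOf y, hxy, hx0]

lemma split1_join {G : Type} {n m : ℕ} (x : Fin (n + 1) → G) (z : Fin (m + 1) → G) :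
    split1 (join x z) = x := by
  ext i
  simp [split1, join, i.2]

instance finite_Ghat {G : Type} [Finite G] [CommGroup G] : Finite (Ghat G) :=
  LinearIndependent.finite (R := ℂ) (f := fun χ : Ghat G => (χ.1 : G → ℂ))
    ((linearIndependent_monoidHom G ℂ).comp (fun χ : Ghat G => χ.1) Subtype.val_injective)

lemma exists_Ghat_ne_one {G : Type} [Fintype G] [CommGroup G]
    (hG : 2 ≤ Fintype.card G) : ∃ χ : Ghat G, χ ≠ 1 := by
  obtain ⟨a, ha⟩ := Fintype.exists_ne_of_one_lt_card (by omega) (1 : G)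
  obtain ⟨φ, hφ⟩ := CommGroup.exists_apply_ne_one_of_hasEnoughRootsOfUnity G ℂ ha
  refine ⟨⟨(Units.coeHom ℂ).comp φ, fun g => ?_⟩, fun h => hφ ?_⟩
  · refine Complex.norm_eq_one_of_pow_eq_one (n := Fintype.card G) ?_ Fintype.card_ne_zero
    rw [← map_pow, pow_card_eq_one, map_one]
  · have := DFunLike.congr_fun (congrArg Subtype.val h) a
    exact Units.ext this

lemma outer_eq_vecMulVec {G : Type} {K : ℕ} (v w : Vec G K) :
    outer v w = vecMulVec v (star w) := rfl

lemma outer_mul_outer {G : Type} [Fintype G] {K : ℕ} (u v w z : Vec G K) :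
    outer u v * outer w z = (star v ⬝ᵥ w) • outer u z := by
  simp only [outer_eq_vecMulVec, vecMulVec_mul_vecMulVec, vecMulVec_smul]

lemma conjTranspose_outer {G : Type} {K : ℕ} (v w : Vec G K) : (outer v w)ᴴ = outer w v := by
  ext x y
  simp [outer, mul_comm]

lemma trace_outer {G : Type} [Fintype G] {K : ℕ} (v w : Vec G K) :
    (outer v w).trace = star w ⬝ᵥ v := by
  simp [outer, Matrix.trace, dotProduct, mul_comm]

lemma inv_sqrt_card_mul_self {G : Type} [Fintype G] :
    ((Real.sqrt (Fintype.card G) : ℂ))⁻¹ * ((Real.sqrt (Fintype.card G) : ℂ))⁻¹ =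
      (Fintype.card G : ℂ)⁻¹ := by
  rw [← mul_inv, ← Complex.ofReal_mul, Real.mul_self_sqrt (Nat.cast_nonneg _)]
  simp

section Lemmas

variable {G : Type} [Fintype G] [DecidableEq G] [CommGroup G]

lemma relKet_apply {k : ℕ} (h : Fin k → G) (χ : Ghat G) (x : Fin (k + 1) → G) :
    relKet h χ x =
      if relOf x = h then ((Real.sqrt (Fintype.card G) : ℂ))⁻¹ * χ.1 (x 0)⁻¹ else 0 := by
  have hx : ∀ g, x = cfg h g ↔ relOf x = h ∧ x 0 = g := fun g =>
    ⟨fun e => by rw [e]; exact ⟨relOf_cfg h g, by simp [cfg]⟩,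
      fun ⟨e1, e2⟩ => by rw [← cfg_relOf x, e1, e2]⟩
  simp only [relKet, ket, Pi.smul_apply, Finset.sum_apply, smul_eq_mul, hx]
  by_cases hr : relOf x = h <;> simp [hr]

lemma relKet_dotProduct_of_ne {k : ℕ} {h j : Fin k → G} (hj : h ≠ j) (χ ψ : Ghat G) :
    star (relKet h χ) ⬝ᵥ relKet j ψ = 0 := by
  refine Finset.sum_eq_zero fun x _ => ?_
  rw [Pi.star_apply, relKet_apply, relKet_apply]
  by_cases hx : relOf x = h
  · simp [hx, hj]
  · simp [hx]

lemma relKet_dotProduct_same {k : ℕ} (h : Fin k → G) (χ ψ : Ghat G) :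
    star (relKet h χ) ⬝ᵥ relKet h ψ =
      (Fintype.card G : ℂ)⁻¹ * ∑ g : G, star (χ.1 g⁻¹) * ψ.1 g⁻¹ := by
  rw [dotProduct, ← (cfgEquiv k).sum_comp, Fintype.sum_prod_type, Fintype.sum_eq_single h,
    Finset.mul_sum]
  · refine Finset.sum_congr rfl fun g _ => ?_
    have h0 : cfg h g 0 = g := by simp [cfg]
    simp only [cfgEquiv, Equiv.coe_fn_mk, Pi.star_apply, relKet_apply, relOf_cfg, h0, if_true,
      ← inv_sqrt_card_mul_self, star_mul', star_inv₀, Complex.star_def, Complex.conj_ofReal]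
    ring
  · intro j hj
    refine Finset.sum_eq_zero fun g _ => ?_
    simp [cfgEquiv, relKet_apply, relOf_cfg, hj]

lemma relKet_dotProduct_self {k : ℕ} (h : Fin k → G) (χ : Ghat G) :
    star (relKet h χ) ⬝ᵥ relKet h χ = 1 := by
  have hχ : ∀ g : G, star (χ.1 g⁻¹) * χ.1 g⁻¹ = 1 := fun g => by
    rw [Complex.star_def, Complex.conj_mul', χ.2]; simp
  rw [relKet_dotProduct_same, Finset.sum_congr rfl fun g _ => hχ g]
  simp

lemma relKet_dotProduct_one {k : ℕ} (h j : Fin k → G) {χ : Ghat G} (hχ : χ ≠ 1) :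
    star (relKet h χ) ⬝ᵥ relKet j 1 = 0 := by
  by_cases hj : h = j
  · subst hj
    have hsum : ∑ g : G, χ.1 g = 0 :=
      sum_hom_units_eq_zero χ.1 fun e => hχ (Subtype.ext e)
    have hone : ∀ g : G, (1 : Ghat G).1 g = 1 := fun _ => rfl
    have hinv : ∑ g : G, χ.1 g⁻¹ = 0 :=
      (Fintype.sum_equiv (Equiv.inv G) _ _ fun _ => rfl).trans hsum
    rw [relKet_dotProduct_same]
    simp only [hone, mul_one]
    rw [← star_sum, hinv, star_zero, mul_zero]
  · exact relKet_dotProduct_of_ne hj χ 1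

open Classical in
lemma PiNot1_eq_sum [Fintype (Ghat G)] {k : ℕ} (h : Fin k → G) :
    PiNot1 h = ∑ χ : Ghat G with χ ≠ 1, outer (relKet h χ) (relKet h χ) :=
  finsum_cond_eq_sum_of_cond_iff _ (by simp)

lemma PiNot1_apply_eq_zero {k : ℕ} (h : Fin k → G) (x y : Fin (k + 1) → G)
    (hxy : ¬(relOf x = h ∧ relOf y = h)) : PiNot1 h x y = 0 := by
  classical
  have := Fintype.ofFinite (Ghat G)
  rw [PiNot1_eq_sum, Matrix.sum_apply]
  refine Finset.sum_eq_zero fun χ _ => ?_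
  rw [outer, Matrix.of_apply, relKet_apply, relKet_apply]
  by_cases hx : relOf x = h
  · simp [show relOf y ≠ h from fun e => hxy ⟨hx, e⟩]
  · simp [hx]

lemma conjTranspose_PiNot1 {k : ℕ} (h : Fin k → G) : (PiNot1 h)ᴴ = PiNot1 h := by
  classical
  have := Fintype.ofFinite (Ghat G)
  simp only [PiNot1_eq_sum, conjTranspose_sum, conjTranspose_outer]

lemma PiNot1_mul_Piphys {k : ℕ} (h : Fin k → G) : PiNot1 h * Piphys G k = 0 := by
  classical
  have := Fintype.ofFinite (Ghat G)
  rw [PiNot1_eq_sum, Piphys, Finset.sum_mul_sum]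
  refine Finset.sum_eq_zero fun χ hχ => Finset.sum_eq_zero fun j _ => ?_
  rw [outer_mul_outer, relKet_dotProduct_one h j (Finset.mem_filter.mp hχ).2, zero_smul]

lemma PiNot1_mul_of_mem_Aphys {k : ℕ} (h : Fin k → G) {B : Op G (k + 1)}
    (hB : B ∈ Aphys G k) : PiNot1 h * B = 0 := by
  have hB' : B = Piphys G k * B * Piphys G k := hB
  rw [hB', Matrix.mul_assoc, ← Matrix.mul_assoc, PiNot1_mul_Piphys, Matrix.zero_mul]

lemma PiNot1_mul_PiNot1_of_ne {k : ℕ} {h j : Fin k → G} (hj : h ≠ j) :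
    PiNot1 h * PiNot1 j = 0 := by
  ext x y
  rw [Matrix.mul_apply, Matrix.zero_apply]
  refine Finset.sum_eq_zero fun z _ => ?_
  by_cases hz : relOf z = h
  · rw [PiNot1_apply_eq_zero j z y fun e => hj (hz.symm.trans e.1), mul_zero]
  · rw [PiNot1_apply_eq_zero h x z fun e => hz e.2, zero_mul]

lemma trace_PiNot1_ne_zero (hG : 2 ≤ Fintype.card G) {k : ℕ} (h : Fin k → G) :
    (PiNot1 h).trace ≠ 0 := by
  classical
  have := Fintype.ofFinite (Ghat G)
  obtain ⟨χ, hχ⟩ := exists_Ghat_ne_one hG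
  simp only [PiNot1_eq_sum, trace_sum, trace_outer, relKet_dotProduct_self, Finset.sum_const,
    nsmul_eq_mul, mul_one]
  exact Nat.cast_ne_zero.mpr (Finset.card_ne_zero_of_mem (by simpa using hχ))

lemma Piphys_mul_outer {k : ℕ} (h : Fin k → G) (w : Vec G (k + 1)) :
    Piphys G k * outer (relKet h 1) w = outer (relKet h 1) w := by
  rw [Piphys, Finset.sum_mul, Fintype.sum_eq_single h, outer_mul_outer, relKet_dotProduct_self,
    one_smul]
  intro j hj
  rw [outer_mul_outer, relKet_dotProduct_of_ne hj, zero_smul]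

lemma outer_mul_Piphys {k : ℕ} (v : Vec G (k + 1)) (h : Fin k → G) :
    outer v (relKet h 1) * Piphys G k = outer v (relKet h 1) := by
  rw [Piphys, Finset.mul_sum, Fintype.sum_eq_single h, outer_mul_outer, relKet_dotProduct_self,
    one_smul]
  intro j hj
  rw [outer_mul_outer, relKet_dotProduct_of_ne hj.symm, zero_smul]

lemma outer_mem_Aphys {k : ℕ} (h j : Fin k → G) :
    outer (relKet h 1) (relKet j 1) ∈ Aphys G k := by
  change _ = _
  rw [Piphys_mul_outer, outer_mul_Piphys]

lemma Aphys_subset_Aalg (k : ℕ) : Aphys G k ⊆ Aalg G k := fun B hB =>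
  ⟨B, hB, 0, by simp⟩

lemma zero_mem_Aphys (k : ℕ) : (0 : Op G (k + 1)) ∈ Aphys G k := by
  change _ = _
  simp

lemma PiNot1_mem_Aalg {k : ℕ} (h : Fin k → G) : PiNot1 h ∈ Aalg G k :=
  ⟨0, zero_mem_Aphys k, Pi.single h 1, by simp [Pi.single_apply, ite_smul]⟩

lemma Piphys_mul_Piphys (k : ℕ) : Piphys G k * Piphys G k = Piphys G k := by
  conv_lhs => enter [1]; rw [Piphys]
  rw [Finset.sum_mul, Finset.sum_congr rfl fun h _ => outer_mul_Piphys _ h, Piphys]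

lemma mul_mem_Aphys {k : ℕ} {A B : Op G (k + 1)} (hA : A ∈ Aphys G k) (hB : B ∈ Aphys G k) :
    A * B ∈ Aphys G k := by
  have hA' : Piphys G k * A * Piphys G k = A := Eq.symm hA
  have hB' : Piphys G k * B * Piphys G k = B := Eq.symm hB
  have hPA : Piphys G k * A = A := by
    rw [← hA', ← Matrix.mul_assoc, ← Matrix.mul_assoc, Piphys_mul_Piphys]
  have hBP : B * Piphys G k = B := by
    rw [← hB', Matrix.mul_assoc, Piphys_mul_Piphys]
  change _ = _
  rw [← Matrix.mul_assoc, hPA, Matrix.mul_assoc, hBP]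

lemma trace_PiNot1_mul_of_isHSProj {k : ℕ} {P : Op G (k + 1) →ₗ[ℂ] Op G (k + 1)}
    (hP : IsHSProj (Aalg G k) P) (s : Fin k → G) (X : Op G (k + 1)) :
    (PiNot1 s * P X).trace = (PiNot1 s * X).trace := by
  have h := hP.2.2 (PiNot1 s) X
  rw [hP.2.1 _ (PiNot1_mem_Aalg s)] at h
  simpa only [hsInner, conjTranspose_PiNot1] using h.symm

open scoped ComplexOrder in
/-- An operator with no Hilbert–Schmidt overlap with any `Π_{s;χ≠𝟙}` is projected
into `A_phys`. -/
lemma isHSProj_mem_Aphys {k : ℕ} {P : Op G (k + 1) →ₗ[ℂ] Op G (k + 1)}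
    (hP : IsHSProj (Aalg G k) P) {X : Op G (k + 1)}
    (hX : ∀ s, (PiNot1 s * X).trace = 0) : P X ∈ Aphys G k := by
  obtain ⟨B, hB, a, hPX⟩ := hP.1 X
  have hzero : ∀ s, a s • PiNot1 s = 0 := fun s => by
    have h := trace_PiNot1_mul_of_isHSProj hP s X
    rw [hX s, hPX, Matrix.mul_add, PiNot1_mul_of_mem_Aphys s hB, zero_add, Finset.mul_sum,
      Fintype.sum_eq_single s fun j hj => by
        rw [Matrix.mul_smul, PiNot1_mul_PiNot1_of_ne hj.symm, smul_zero],
      Matrix.mul_smul, trace_smul, smul_eq_mul] at h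
    rcases mul_eq_zero.mp h with ha | hQ
    · rw [ha, zero_smul]
    · rw [← conjTranspose_PiNot1] at hQ
      nth_rewrite 2 [← conjTranspose_PiNot1] at hQ
      rw [conjTranspose_conjTranspose] at hQ
      rw [trace_conjTranspose_mul_self_eq_zero_iff.mp hQ, smul_zero]
  rw [hPX, Finset.sum_eq_zero fun s _ => hzero s, add_zero]
  exact hB

lemma tensorOp_outer_one_apply {n m : ℕ} (h j : Fin n → G) (x y : Fin (n + m + 1 + 1) → G) :
    tensorOp (outer (relKet h 1) (relKet j 1)) (1 : Op G (m + 1)) x y =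
      if relOf (split1 x) = h ∧ relOf (split1 y) = j ∧ split2 x = split2 y then
        (Fintype.card G : ℂ)⁻¹ else 0 := by
  have hone : ∀ g : G, (1 : Ghat G).1 g = 1 := fun _ => rfl
  simp only [tensorOp, outer, Matrix.of_apply, relKet_apply, hone, mul_one, Matrix.one_apply]
  by_cases h1 : relOf (split1 x) = h
  · by_cases h2 : relOf (split1 y) = j
    · by_cases h3 : split2 x = split2 y
      · simp only [h1, h2, h3, and_self, if_true, ← inv_sqrt_card_mul_self, map_inv₀,
          Complex.conj_ofReal, mul_one]
      · simp [h3]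
    · simp [h2]
  · simp [h1]

lemma trace_PiNot1_mul_tensorOp_of_ne {n m : ℕ} {h j : Fin n → G} (hj : h ≠ j)
    (s : Fin (n + m + 1) → G) :
    (PiNot1 s * tensorOp (outer (relKet h 1) (relKet j 1)) (1 : Op G (m + 1))).trace = 0 := by
  refine Finset.sum_eq_zero fun x _ => ?_
  rw [diag_apply, Matrix.mul_apply]
  refine Finset.sum_eq_zero fun y _ => ?_
  by_cases hs : relOf x = s ∧ relOf y = s
  · rw [tensorOp_outer_one_apply, if_neg, mul_zero]
    rintro ⟨e1, e2, -⟩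
    exact hj (e1.symm.trans ((relOf_split1_congr (hs.2.trans hs.1.symm)).trans e2))
  · rw [PiNot1_apply_eq_zero s x y hs, zero_mul]

lemma trace_PiNot1_mul_tensorOp_self {n m : ℕ} {h : Fin n → G} {w : Fin (n + m + 1 + 1) → G}
    (hw : relOf (split1 w) = h) :
    (PiNot1 (relOf w) * tensorOp (outer (relKet h 1) (relKet h 1)) (1 : Op G (m + 1))).trace =
      (PiNot1 (relOf w)).trace * (Fintype.card G : ℂ)⁻¹ := by
  rw [Matrix.trace, Matrix.trace, Finset.sum_mul]
  refine Finset.sum_congr rfl fun x _ => ?_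
  rw [diag_apply, diag_apply, Matrix.mul_apply, Fintype.sum_eq_single x]
  · by_cases hx : relOf x = relOf w
    · have hx1 : relOf (split1 x) = h := (relOf_split1_congr hx).trans hw
      rw [tensorOp_outer_one_apply, if_pos ⟨hx1, hx1, rfl⟩]
    · rw [PiNot1_apply_eq_zero _ x x fun e => hx e.1, zero_mul, zero_mul]
  · intro y hyx
    by_cases hs : relOf x = relOf w ∧ relOf y = relOf w
    · rw [tensorOp_outer_one_apply, if_neg, mul_zero]
      rintro ⟨-, -, e⟩
      exact hyx (eq_of_relOf_eq_of_split2_eq (hs.2.trans hs.1.symm) e)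
    · rw [PiNot1_apply_eq_zero _ x y hs, zero_mul]

lemma isHSProj_tensorOp_mul_ne {n m : ℕ} (hG : 2 ≤ Fintype.card G)
    {P : Op G (n + m + 1 + 1) →ₗ[ℂ] Op G (n + m + 1 + 1)}
    (hP : IsHSProj (Aalg G (n + m + 1)) P) {h j : Fin n → G} (hj : h ≠ j) :
    P (tensorOp (outer (relKet h 1) (relKet j 1)) (1 : Op G (m + 1))) *
        P (tensorOp (outer (relKet j 1) (relKet h 1)) (1 : Op G (m + 1))) ≠
      P (tensorOp (outer (relKet h 1) (relKet h 1)) (1 : Op G (m + 1))) := by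
  intro heq
  have hmem := mul_mem_Aphys
    (isHSProj_mem_Aphys hP (trace_PiNot1_mul_tensorOp_of_ne (m := m) hj))
    (isHSProj_mem_Aphys hP (trace_PiNot1_mul_tensorOp_of_ne (m := m) hj.symm))
  rw [heq] at hmem
  let w : Fin (n + m + 1 + 1) → G := join (cfg h 1) (1 : Fin (m + 1) → G)
  have hw : relOf (split1 w) = h := by rw [split1_join, relOf_cfg]
  have htr := trace_PiNot1_mul_of_isHSProj hP (relOf w)
    (tensorOp (outer (relKet h 1) (relKet h 1)) (1 : Op G (m + 1)))
  rw [PiNot1_mul_of_mem_Aphys _ hmem, trace_PiNot1_mul_tensorOp_self hw, trace_zero] at htr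
  exact mul_ne_zero (trace_PiNot1_ne_zero hG _)
    (inv_ne_zero (Nat.cast_ne_zero.mpr Fintype.card_ne_zero)) htr.symm

end Lemmas

/-- The map `Φ̃(A) := Π_alg^{(N+M)}(A ⊗ 1)` on `A_alg^{(N)}` is not
multiplicative: for any `h ≠ j`,
`Φ̃(|h;𝟙⟩⟨j;𝟙|) Φ̃(|j;𝟙⟩⟨h;𝟙|) ≠ Φ̃(|h;𝟙⟩⟨h;𝟙|)`.  (Here `PK` is the HS-orthogonal
projection onto `A_alg^{(N+M)}`.) -/
theorem stmt15 (G : Type) [Fintype G] [DecidableEq G] [CommGroup G] (n m : ℕ)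
    (hn : 1 ≤ n) (hG : 2 ≤ Fintype.card G)
    (PK : Op G (n + m + 1 + 1) →ₗ[ℂ] Op G (n + m + 1 + 1))
    (hPK : IsHSProj (Aalg G (n + m + 1)) PK) :
    (∃ A ∈ Aalg G n, ∃ B ∈ Aalg G n,
      PK (tensorOp (A * B) (1 : Op G (m + 1))) ≠
        PK (tensorOp A (1 : Op G (m + 1))) * PK (tensorOp B (1 : Op G (m + 1)))) ∧
    (∀ h j : Fin n → G, h ≠ j →
      PK (tensorOp (outer (relKet h (1 : Ghat G)) (relKet j (1 : Ghat G)))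
            (1 : Op G (m + 1))) *
          PK (tensorOp (outer (relKet j (1 : Ghat G)) (relKet h (1 : Ghat G)))
            (1 : Op G (m + 1))) ≠
        PK (tensorOp (outer (relKet h (1 : Ghat G)) (relKet h (1 : Ghat G)))
            (1 : Op G (m + 1)))) := by
  refine ⟨?_, fun h j hj => isHSProj_tensorOp_mul_ne hG hPK hj⟩
  obtain ⟨a, ha⟩ := Fintype.exists_ne_of_one_lt_card (by omega) (1 : G)
  have hj : (fun _ => a : Fin n → G) ≠ 1 := fun e => ha (congrFun e ⟨0, hn⟩)
  refine ⟨_, Aphys_subset_Aalg n (outer_mem_Aphys (fun _ => a) 1), _,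
    Aphys_subset_Aalg n (outer_mem_Aphys 1 (fun _ => a)), ?_⟩
  rw [outer_mul_outer, relKet_dotProduct_self, one_smul]
  exact (isHSProj_tensorOp_mul_ne hG hPK hj).symm

end QRF

end
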